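/- Let n ≥ 1 be an integer, λ ≥ 0 a real number, p ∈ [0,1], and set q = (1−p)ⁿ. Then q·exp(λ·(p − p·q)) + (1−q)·exp(−λ·p·q) ≤ exp( p·λ²/(4n) ). -/

import Mathlib

/-- The function `tanh x / x` is nonincreasing on the positive reals. -/
theorem antitoneOn_sinh_div_mul_cosh :
    AntitoneOn (fun x : ℝ => Real.sinh x / (x * Real.cosh x)) (Set.Ioi 0) := by
  have hd : ∀ x ∈ Set.Ioi (0 : ℝ), HasDerivAt (fun x : ℝ => Real.sinh x / (x * Real.cosh x))
      ((Real.cosh x * (x * Real.cosh x) - Real.sinh x * (1 * Real.cosh x + x * Real.sinh x))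
        / (x * Real.cosh x) ^ 2) x := fun x hx =>
    (Real.hasDerivAt_sinh x).div ((hasDerivAt_id' x).mul (Real.hasDerivAt_cosh x))
      (mul_pos hx (Real.cosh_pos x)).ne'
  refine antitoneOn_of_deriv_nonpos (convex_Ioi 0)
    (fun x hx => (hd x hx).continuousAt.continuousWithinAt)
    (fun x hx => (hd x (interior_subset hx)).differentiableAt.differentiableWithinAt) ?_
  intro x hx
  have hx0 : 0 < x := interior_subset hx
  rw [(hd x hx0).deriv]
  refine div_nonpos_of_nonpos_of_nonneg ?_ (sq_nonneg _)
  have h1 : x ≤ Real.sinh x := Real.self_le_sinh_iff.mpr hx0.le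
  have h2 := Real.one_le_cosh x
  have h3 := Real.cosh_sq x
  nlinarith [mul_nonneg (hx0.le.trans h1) (sub_nonneg.mpr h2)]

/-- Quadratic upper bound for `log cosh` touching at `x`, in exponential form. -/
theorem cosh_le_cosh_mul_exp_of_pos {x : ℝ} (hx : 0 < x) (s : ℝ) :
    Real.cosh s ≤ Real.cosh x *
      Real.exp (Real.sinh x / (x * Real.cosh x) / 2 * (s ^ 2 - x ^ 2)) := by
  set c := Real.sinh x / (x * Real.cosh x) / 2 with hc
  have hd : ∀ y : ℝ, HasDerivAt (fun y : ℝ => Real.cosh y * Real.exp (-c * y ^ 2))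
      ((Real.sinh y - 2 * c * y * Real.cosh y) * Real.exp (-c * y ^ 2)) y := by
    intro y
    have h := (Real.hasDerivAt_cosh y).mul (((hasDerivAt_pow 2 y).const_mul (-c)).exp)
    refine h.congr_deriv ?_
    push_cast
    ring
  have hsign : ∀ y : ℝ, 0 < y → Real.sinh y - 2 * c * y * Real.cosh y
      = (Real.sinh y / (y * Real.cosh y) - Real.sinh x / (x * Real.cosh x))
        * (y * Real.cosh y) := by
    intro y hy
    have := (Real.cosh_pos y).ne'
    rw [sub_mul, div_mul_cancel₀ _ (by positivity), hc]
    ring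
  have hcont : Continuous (fun y : ℝ => Real.cosh y * Real.exp (-c * y ^ 2)) := by fun_prop
  have hup : MonotoneOn (fun y : ℝ => Real.cosh y * Real.exp (-c * y ^ 2)) (Set.Icc 0 x) := by
    refine monotoneOn_of_deriv_nonneg (convex_Icc 0 x) hcont.continuousOn
      (fun y _ => (hd y).differentiableAt.differentiableWithinAt) ?_
    intro y hy
    rw [interior_Icc] at hy
    rw [(hd y).deriv, hsign y hy.1]
    have h := antitoneOn_sinh_div_mul_cosh hy.1 hx hy.2.le
    exact mul_nonneg (mul_nonneg (sub_nonneg.mpr h)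
      (mul_nonneg hy.1.le (Real.cosh_pos y).le)) (Real.exp_pos _).le
  have hdown : AntitoneOn (fun y : ℝ => Real.cosh y * Real.exp (-c * y ^ 2)) (Set.Ici x) := by
    refine antitoneOn_of_deriv_nonpos (convex_Ici x) hcont.continuousOn
      (fun y _ => (hd y).differentiableAt.differentiableWithinAt) ?_
    intro y hy
    rw [interior_Ici] at hy
    have hy0 : 0 < y := hx.trans hy
    rw [(hd y).deriv, hsign y hy0]
    have h := antitoneOn_sinh_div_mul_cosh hx hy0 (le_of_lt hy)
    exact mul_nonpos_of_nonpos_of_nonneg (mul_nonpos_of_nonpos_of_nonneg (sub_nonpos.mpr h)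
      (mul_nonneg hy0.le (Real.cosh_pos y).le)) (Real.exp_pos _).le
  have key : Real.cosh |s| * Real.exp (-c * |s| ^ 2) ≤ Real.cosh x * Real.exp (-c * x ^ 2) := by
    rcases le_total |s| x with h | h
    · exact hup ⟨abs_nonneg s, h⟩ ⟨hx.le, le_rfl⟩ h
    · exact hdown Set.self_mem_Ici h h
  rw [Real.cosh_abs, sq_abs] at key
  calc Real.cosh s = Real.cosh s * Real.exp (-c * s ^ 2) * Real.exp (c * s ^ 2) := by
        rw [mul_assoc, ← Real.exp_add]; simp
    _ ≤ Real.cosh x * Real.exp (-c * x ^ 2) * Real.exp (c * s ^ 2) := by gcongr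
    _ = _ := by rw [mul_assoc, ← Real.exp_add]; ring_nf

theorem cosh_le_cosh_mul_exp {x : ℝ} (hx : x ≠ 0) (s : ℝ) :
    Real.cosh s ≤ Real.cosh x *
      Real.exp (Real.sinh x / (x * Real.cosh x) / 2 * (s ^ 2 - x ^ 2)) := by
  rcases hx.lt_or_gt with h | h
  · simpa [neg_div_neg_eq] using cosh_le_cosh_mul_exp_of_pos (neg_pos.mpr h) s
  · exact cosh_le_cosh_mul_exp_of_pos h s

/-- The **Kearns–Saul inequality**: the optimal sub-Gaussian bound for a centered
Bernoulli variable. -/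
theorem kearns_saul {q : ℝ} (hq0 : 0 < q) (hq1 : q < 1) (hq : q ≠ 1 / 2) (t : ℝ) :
    q * Real.exp (t * (1 - q)) + (1 - q) * Real.exp (-(t * q))
      ≤ Real.exp ((1 - 2 * q) / (Real.log (1 - q) - Real.log q) * t ^ 2 / 4) := by
  have hr : 0 < 1 - q := sub_pos.mpr hq1
  set l := Real.log (1 - q) - Real.log q with hl
  have hl0 : l ≠ 0 := fun h => hq (by
    have := Real.log_injOn_pos (Set.mem_Ioi.mpr hr) (Set.mem_Ioi.mpr hq0) (sub_eq_zero.mp h)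
    linarith)
  set m := (Real.log (1 - q) + Real.log q) / 2 with hm
  have hqe : q = Real.exp m * Real.exp (-(l / 2)) := by
    rw [← Real.exp_add, hm, hl]; ring_nf; exact (Real.exp_log hq0).symm
  have hre : 1 - q = Real.exp m * Real.exp (l / 2) := by
    rw [← Real.exp_add, hm, hl]; ring_nf; exact (Real.exp_log hr).symm
  have hcosh : 2 * Real.exp m * Real.cosh (l / 2) = 1 := by
    rw [Real.cosh_eq]; linarith
  have hsinh : 2 * Real.exp m * Real.sinh (l / 2) = 1 - 2 * q := by
    rw [Real.sinh_eq]; linarith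
  have htanh : Real.sinh (l / 2) / (l / 2 * Real.cosh (l / 2)) / 2 = (1 - 2 * q) / l := by
    have hC := (Real.cosh_pos (l / 2)).ne'
    have : Real.sinh (l / 2) = (1 - 2 * q) * Real.cosh (l / 2) := by
      linear_combination Real.cosh (l / 2) * hsinh - Real.sinh (l / 2) * hcosh
    rw [this]
    field_simp
  have hb := cosh_le_cosh_mul_exp (div_ne_zero hl0 two_ne_zero) ((t - l) / 2)
  rw [htanh] at hb
  calc q * Real.exp (t * (1 - q)) + (1 - q) * Real.exp (-(t * q))
      = Real.exp (t * (1 / 2 - q)) * (2 * Real.exp m * Real.cosh ((t - l) / 2)) := by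
        have e1 : Real.exp (t * (1 - q))
            = Real.exp (t * (1 / 2 - q)) * Real.exp (l / 2) * Real.exp ((t - l) / 2) := by
          rw [← Real.exp_add, ← Real.exp_add]; ring_nf
        have e2 : Real.exp (-(t * q))
            = Real.exp (t * (1 / 2 - q)) * Real.exp (-(l / 2)) * Real.exp (-((t - l) / 2)) := by
          rw [← Real.exp_add, ← Real.exp_add]; ring_nf
        have e3 : Real.exp (l / 2) * Real.exp (-(l / 2)) = 1 := by
          rw [← Real.exp_add]; simp
        rw [Real.cosh_eq, e1, e2, hre]
        nth_rewrite 1 [hqe]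
        linear_combination Real.exp m * Real.exp (t * (1 / 2 - q)) *
          (Real.exp ((t - l) / 2) + Real.exp (-((t - l) / 2))) * e3
    _ ≤ Real.exp (t * (1 / 2 - q)) * (2 * Real.exp m * (Real.cosh (l / 2) *
          Real.exp ((1 - 2 * q) / l * (((t - l) / 2) ^ 2 - (l / 2) ^ 2)))) := by gcongr
    _ = Real.exp (t * (1 / 2 - q)) *
          Real.exp ((1 - 2 * q) / l * (((t - l) / 2) ^ 2 - (l / 2) ^ 2)) := by
        rw [← mul_assoc (2 * Real.exp m), hcosh, one_mul]
    _ = _ := by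
        rw [← Real.exp_add]
        congr 1
        field_simp
        ring

theorem concaveOn_log_one_sub_add_negMulLog :
    ConcaveOn ℝ (Set.Ico 0 1) (fun q : ℝ => Real.log (1 - q) + 2 * Real.negMulLog q) := by
  have h1 : ConcaveOn ℝ (Set.Ico 0 1) (fun q : ℝ => Real.log (1 - q)) := by
    refine ⟨convex_Ico 0 1, fun x hx y hy a b ha hb hab => ?_⟩
    have := strictConcaveOn_log_Ioi.concaveOn.2 (x := 1 - x) (y := 1 - y)
      (Set.mem_Ioi.mpr (sub_pos.mpr hx.2)) (Set.mem_Ioi.mpr (sub_pos.mpr hy.2)) ha hb hab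
    refine this.trans_eq (congrArg Real.log ?_)
    simp only [smul_eq_mul]
    linear_combination hab
  have h2 : ConcaveOn ℝ (Set.Ico 0 1) Real.negMulLog :=
    Real.concaveOn_negMulLog.subset Set.Ico_subset_Ici_self (convex_Ico 0 1)
  exact h1.add (h2.smul zero_le_two)

/-- The Kearns–Saul constant is at most `1 / log (1 / q)`. -/
theorem kearns_saul_const_mul_le_one {q : ℝ} (hq0 : 0 < q) (hq1 : q < 1) (hq : q ≠ 1 / 2) :
    0 ≤ (1 - 2 * q) / (Real.log (1 - q) - Real.log q) ∧
      (1 - 2 * q) / (Real.log (1 - q) - Real.log q) * (-Real.log q) ≤ 1 := by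
  have hr : 0 < 1 - q := sub_pos.mpr hq1
  have hhalf : Real.log (1 - 1 / 2) + 2 * Real.negMulLog (1 / 2) = 0 := by
    rw [Real.negMulLog]; norm_num; ring
  have hφ : ∀ y ∈ Set.Ico (0 : ℝ) 1, ∀ b : ℝ, 0 ≤ b → b ≤ 1 →
      b * (Real.log (1 - y) + 2 * Real.negMulLog y)
        ≤ Real.log (1 - b * y) + 2 * Real.negMulLog (b * y) := fun y hy b hb hb1 => by
    simpa using concaveOn_log_one_sub_add_negMulLog.2 (Set.left_mem_Ico.mpr one_pos) hy
      (sub_nonneg.mpr hb1) hb (sub_add_cancel 1 b)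
  have hφq : Real.log (1 - q) + 2 * Real.negMulLog q
      = Real.log (1 - q) - 2 * q * Real.log q := by rw [Real.negMulLog]; ring
  rcases hq.lt_or_gt with h | h
  · have hl : 0 < Real.log (1 - q) - Real.log q :=
      sub_pos.mpr (Real.log_lt_log hq0 (by linarith))
    refine ⟨div_nonneg (by linarith) hl.le, ?_⟩
    have := hφ (1 / 2) (by norm_num) (2 * q) (by linarith) (by linarith)
    rw [hhalf, mul_zero, show 2 * q * (1 / 2) = q by ring, hφq] at this
    rw [div_mul_eq_mul_div, div_le_one hl]
    linarith
  · have hl : Real.log (1 - q) - Real.log q < 0 :=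
      sub_neg.mpr (Real.log_lt_log hr (by linarith))
    refine ⟨div_nonneg_of_nonpos (by linarith) hl.le, ?_⟩
    have hb : 1 / (2 * q) ≤ 1 := by
      rw [div_le_one (by positivity)]; linarith
    have := hφ q ⟨hq0.le, hq1⟩ (1 / (2 * q)) (by positivity) hb
    rw [show 1 / (2 * q) * q = 1 / 2 by field_simp, hhalf, hφq] at this
    have := nonpos_of_mul_nonpos_right this (by positivity)
    rw [div_mul_eq_mul_div, div_le_one_of_neg hl]
    linarith

/-- A centered Bernoulli variable with success probability `q` is sub-Gaussian with variance
proxy `1 / (2 * a)` for every `0 < a ≤ log (1 / q)`. -/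
theorem bernoulli_mgf_le_exp {q a : ℝ} (hq0 : 0 < q) (hq1 : q < 1) (ha0 : 0 < a)
    (ha : a ≤ -Real.log q) (t : ℝ) :
    q * Real.exp (t * (1 - q)) + (1 - q) * Real.exp (-(t * q))
      ≤ Real.exp (t ^ 2 / (4 * a)) := by
  by_cases hq : q = 1 / 2
  · have hcosh : q * Real.exp (t * (1 - q)) + (1 - q) * Real.exp (-(t * q))
        = Real.cosh (t / 2) := by
      rw [Real.cosh_eq, hq]; ring_nf
    rw [hcosh]
    refine (Real.cosh_le_exp_half_sq _).trans (Real.exp_le_exp.mpr ?_)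
    have ha2 : a ≤ 1 := by
      refine ha.trans ?_
      rw [hq, one_div, Real.log_inv, neg_neg]
      exact Real.log_two_lt_d9.le.trans (by norm_num)
    rw [le_div_iff₀ (by positivity)]
    nlinarith [mul_nonneg (sq_nonneg t) (sub_nonneg.mpr ha2), sq_nonneg t]
  · obtain ⟨h0, h1⟩ := kearns_saul_const_mul_le_one hq0 hq1 hq
    refine (kearns_saul hq0 hq1 hq t).trans (Real.exp_le_exp.mpr ?_)
    have h2 := (mul_le_mul_of_nonneg_left ha h0).trans h1
    rw [le_div_iff₀ (by positivity)]
    nlinarith [mul_nonneg (sq_nonneg t) (sub_nonneg.mpr h2)]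

/-- Lemma (a): for `n ≥ 1`, `λ ≥ 0`, `p ∈ [0,1]`, `q = (1-p)ⁿ`,
`q e^{λ(p - pq)} + (1-q) e^{-λpq} ≤ exp(pλ²/(4n))`. -/
theorem lamp_a (n : ℕ) (hn : 1 ≤ n) (lam p : ℝ) (hlam : 0 ≤ lam)
    (hp0 : 0 ≤ p) (hp1 : p ≤ 1) :
    (1 - p)^n * Real.exp (lam * (p - p * (1 - p)^n))
      + (1 - (1 - p)^n) * Real.exp (-lam * p * (1 - p)^n)
    ≤ Real.exp (p * lam^2 / (4 * n)) := by
  have hn0 : n ≠ 0 := Nat.one_le_iff_ne_zero.mp hn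
  have hn' : (0 : ℝ) < n := Nat.cast_pos.mpr hn
  rcases hp0.eq_or_lt with rfl | hp0
  · simp
  rcases hp1.eq_or_lt with rfl | hp1
  · simp only [sub_self, zero_pow hn0, mul_zero, zero_mul, zero_add, sub_zero, Real.exp_zero,
      mul_one]
    exact Real.one_le_exp (by positivity)
  have hr : 0 < 1 - p := sub_pos.mpr hp1
  have hlog : n * p ≤ -Real.log ((1 - p) ^ n) := by
    rw [Real.log_pow]
    nlinarith [Real.log_le_sub_one_of_pos hr]
  have h := bernoulli_mgf_le_exp (pow_pos hr n) (pow_lt_one₀ hr.le (by linarith) hn0)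
    (mul_pos hn' hp0) hlog (lam * p)
  convert h using 2
  · ring_nf
  · ring_nf
  · field_simp
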